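/- arXiv:1507.05317 — 2 statements merged into one kernel-verified Lean document; each statement's English description precedes it below -/
import Mathlib

section
/- Let C = P + εQ ∈ 𝔻ℍ[t] be a monic motion polynomial of degree n whose primal part P ∈ ℍ[t] is divisible by no nonconstant real polynomial. Then there exist dual quaternions h₁, …, hₙ such that C = (t − h₁)(t − h₂)⋯(t − hₙ), where each factor t − hᵢ is a motion polynomial whose coefficient hᵢ has non-real primal part (i.e., each t − hᵢ is a rotation polynomial). -/
noncomputable section
open Polynomial

/-- The real quaternions ℍ. -/
abbrev Quat := Quaternion ℝ

/-- The dual quaternions 𝔻ℍ = ℍ ⊕ εℍ, realized as dual numbers over ℍ.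
An element is a pair `(p, q)` representing `p + εq`. -/
abbrev DQ := DualNumber Quat

/-- Conjugation of a dual quaternion `p + εq ↦ p̄ + εq̄`,
conjugating each quaternion part. -/
def dconj (h : DQ) : DQ := (star h.fst, star h.snd)

/-- The canonical ring homomorphism ℝ → 𝔻ℍ. -/
def realToDQ : ℝ →+* DQ := (TrivSqZeroExt.inlHom Quat Quat).comp (algebraMap ℝ Quat)

/-- Coefficientwise conjugate of a polynomial over 𝔻ℍ. -/
def pconj (C : DQ[X]) : DQ[X] := C.sum fun n a => Polynomial.C (dconj a) * X ^ n

/-- `C ∈ 𝔻ℍ[t]` is a motion polynomial if `C C̄ ∈ ℝ[t] \ {0}` and the leading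
coefficient of `C` is invertible. -/
def IsMotionPoly (C : DQ[X]) : Prop :=
  (∃ R : ℝ[X], R ≠ 0 ∧ C * pconj C = R.map realToDQ) ∧ IsUnit C.leadingCoeff

/-- The action of a dual quaternion `p + εq` (with `p ≠ 0` and satisfying the Study
condition) on a pure quaternion `x`:  `x ↦ (p x p̄ + p q̄ − q p̄)/N(p)`. -/
def act (p q x : Quat) : Quat :=
  (p * x * star p + p * star q - q * star p) * (p * star p)⁻¹

/-- The dual quaternion `p + εq` from its primal part `p` and dual part `q`. -/
def dq (p q : Quat) : DQ := (p, q)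

/-- The primal part of a polynomial over 𝔻ℍ: take the primal part of each
coefficient, giving a polynomial over ℍ. -/
def primal (C : DQ[X]) : Quat[X] :=
  C.map (TrivSqZeroExt.fstHom ℝ Quat Quat).toRingHom

/-- `P ∈ ℍ[t]` is divisible by no nonconstant real polynomial. -/
def NoRealFactor (P : Quat[X]) : Prop :=
  ∀ R : ℝ[X], 0 < R.natDegree → ¬ R.map (algebraMap ℝ Quat) ∣ P

theorem dconj_add (a b : DQ) : dconj (a + b) = dconj a + dconj b := by
  apply TrivSqZeroExt.ext
  · exact star_add a.fst b.fst
  · exact star_add a.snd b.snd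

theorem dconj_zero : dconj 0 = 0 := by
  apply TrivSqZeroExt.ext
  · exact star_zero Quat
  · exact star_zero Quat

theorem dconj_one : dconj 1 = 1 := by
  apply TrivSqZeroExt.ext
  · exact star_one Quat
  · exact star_zero Quat

theorem dconj_mul (a b : DQ) : dconj (a * b) = dconj b * dconj a := by
  apply TrivSqZeroExt.ext
  · exact star_mul a.fst b.fst
  · have h1 : (dconj (a * b)).snd = star (a.fst * b.snd + a.snd * b.fst) := by
      rfl
    have h2 : (dconj b * dconj a).snd = star b.fst * star a.snd + star b.snd * star a.fst := rfl
    rw [h1, h2, star_add, star_mul, star_mul, add_comm]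

theorem dconj_real (r : ℝ) : dconj (realToDQ r) = realToDQ r := by
  apply TrivSqZeroExt.ext
  · exact Quaternion.star_coe r
  · exact star_zero Quat

theorem realToDQ_comm (r : ℝ) (a : DQ) : realToDQ r * a = a * realToDQ r := by
  have : realToDQ r = algebraMap ℝ DQ r := rfl
  rw [this, Algebra.commutes]

theorem coeff_pconj (C : DQ[X]) (n : ℕ) : (pconj C).coeff n = dconj (C.coeff n) := by
  unfold pconj
  rw [Polynomial.sum_def, Polynomial.finsetSum_coeff]
  simp only [coeff_C_mul, coeff_X_pow, mul_ite, mul_one, mul_zero]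
  rw [Finset.sum_ite_eq]
  split_ifs with h
  · rfl
  · rw [notMem_support_iff.mp h, dconj_zero]

theorem pconj_add (A B : DQ[X]) : pconj (A + B) = pconj A + pconj B := by
  ext1 n
  simp only [coeff_pconj, coeff_add, dconj_add]

theorem dconj_sum {ι : Type*} (s : Finset ι) (f : ι → DQ) :
    dconj (∑ i ∈ s, f i) = ∑ i ∈ s, dconj (f i) :=
  map_sum (AddMonoidHom.mk' dconj dconj_add) f s

theorem pconj_mul (A B : DQ[X]) : pconj (A * B) = pconj B * pconj A := by
  ext1 n
  rw [coeff_pconj, coeff_mul, coeff_mul, dconj_sum, ← Finset.Nat.sum_antidiagonal_swap]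
  simp only [coeff_pconj, dconj_mul, Prod.fst_swap, Prod.snd_swap]

theorem pconj_real (R : ℝ[X]) : pconj (R.map realToDQ) = R.map realToDQ := by
  ext1 n
  rw [coeff_pconj, coeff_map, dconj_real]

theorem pconj_C (a : DQ) : pconj (Polynomial.C a) = Polynomial.C (dconj a) := by
  ext1 n
  rw [coeff_pconj, coeff_C, coeff_C]
  split_ifs
  · rfl
  · exact dconj_zero

theorem real_comm (R : ℝ[X]) (A : DQ[X]) : R.map realToDQ * A = A * R.map realToDQ := by
  ext1 n
  rw [coeff_mul, coeff_mul, ← Finset.Nat.sum_antidiagonal_swap]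
  simp only [coeff_map, realToDQ_comm, Prod.fst_swap, Prod.snd_swap]

theorem primal_real (R : ℝ[X]) : primal (R.map realToDQ) = R.map (algebraMap ℝ Quat) := by
  unfold primal
  rw [Polynomial.map_map]
  rfl

theorem primal_mul (A B : DQ[X]) : primal (A * B) = primal A * primal B :=
  Polynomial.map_mul _

theorem primal_add (A B : DQ[X]) : primal (A + B) = primal A + primal B :=
  Polynomial.map_add _

theorem coeff_primal (A : DQ[X]) (n : ℕ) : (primal A).coeff n = (A.coeff n).fst :=
  coeff_map _ _

theorem fst_norm_zero {a : DQ} (h : (a * dconj a).fst = 0) : a.fst = 0 := by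
  have h1 : (a * dconj a).fst = a.fst * star a.fst := rfl
  rw [h1] at h
  rcases mul_eq_zero.mp h with h | h
  · exact h
  · exact star_eq_zero.mp h

/-- a real root of the norm polynomial would give a real linear factor -/
theorem no_root {C : DQ[X]} {R : ℝ[X]} (hR : C * pconj C = R.map realToDQ)
    (hprim : NoRealFactor (primal C)) (r : ℝ) : ¬ R.IsRoot r := by
  intro hr
  -- write C = (X - r) * D + const
  set L : ℝ[X] := X - Polynomial.C r with hL
  have hLm : L.Monic := monic_X_sub_C r
  have hLmap : (L.map realToDQ).Monic := hLm.map _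
  obtain ⟨R', rfl⟩ := dvd_iff_isRoot.mpr hr
  have hdiv := modByMonic_add_div C (L.map realToDQ)
  have hdeg : (C %ₘ (L.map realToDQ)).degree < 1 := by
    have := degree_modByMonic_lt C hLmap
    rwa [hLm.degree_map, hL, degree_X_sub_C] at this
  have hS := eq_C_of_degree_le_zero (p := C %ₘ (L.map realToDQ)) (by
    exact Nat.WithBot.lt_one_iff_le_zero.mp hdeg)
  set a := (C %ₘ (L.map realToDQ)).coeff 0
  set D := C /ₘ (L.map realToDQ)
  rw [hS] at hdiv
  have hdvd : L.map realToDQ ∣ Polynomial.C (a * dconj a) := by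
    rw [← hdiv, pconj_add, pconj_mul, pconj_C, pconj_real, mul_add, add_mul, add_mul, ← Polynomial.C_mul, Polynomial.map_mul] at hR
    refine (dvd_add_right (a := L.map realToDQ) (b := L.map realToDQ * D * Polynomial.C (dconj a) + (Polynomial.C a * (pconj D * L.map realToDQ) + L.map realToDQ * D * (pconj D * L.map realToDQ))) ?_).mp ?_
    · refine dvd_add ⟨D * Polynomial.C (dconj a), by rw [mul_assoc]⟩ (dvd_add ⟨Polynomial.C a * pconj D, ?_⟩ ⟨D * (pconj D * L.map realToDQ), by rw [mul_assoc]⟩)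
      rw [real_comm, mul_assoc]
    · refine ⟨R'.map realToDQ, ?_⟩
      rw [← hR]; abel
  obtain ⟨K, hK⟩ := hdvd
  have hz : a * dconj a = 0 := by
    by_contra hne
    have hK0 : K ≠ 0 := by
      rintro rfl
      rw [mul_zero, Polynomial.C_eq_zero] at hK
      exact hne hK
    have h2 := congrArg natDegree hK
    rw [natDegree_C, hLmap.natDegree_mul' hK0, hLm.natDegree_map, hL, natDegree_X_sub_C] at h2
    omega
  have ha : a.fst = 0 := fst_norm_zero (by rw [hz]; rfl)
  refine hprim L (by rw [hL, natDegree_X_sub_C]; exact one_pos) ⟨primal D, ?_⟩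
  rw [← hdiv, primal_add, primal_mul, primal_real]
  have : primal (Polynomial.C a) = 0 := by
    unfold primal
    rw [Polynomial.map_C]
    have : (TrivSqZeroExt.fstHom ℝ Quat Quat).toRingHom a = 0 := ha
    rw [this, Polynomial.C_0]
  rw [this, zero_add]

theorem exists_quadratic {C : DQ[X]} {R : ℝ[X]} (hC : C.Monic) (hd : 0 < C.natDegree)
    (hR : C * pconj C = R.map realToDQ) (hR0 : R ≠ 0)
    (hprim : NoRealFactor (primal C)) : ∃ M : ℝ[X], M.Monic ∧ M.natDegree = 2 ∧ M ∣ R := by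
  have hnu : ¬ IsUnit R := by
    intro hu
    have h0 := natDegree_eq_zero_of_isUnit hu
    have hp0 : pconj C ≠ 0 := by
      intro h
      rw [h, mul_zero] at hR
      have : (1 : DQ) = 0 := by
        have := coeff_pconj C C.natDegree
        rw [h, coeff_zero, hC.coeff_natDegree, dconj_one] at this
        exact this.symm
      exact one_ne_zero this
    have h2 := congrArg natDegree hR
    rw [hC.natDegree_mul' hp0] at h2
    have := natDegree_map_le (f := realToDQ) (p := R)
    omega
  obtain ⟨g, hg, hgR⟩ := WfDvdMonoid.exists_irreducible_factor hnu hR0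
  have hle := hg.natDegree_le_two
  have hpos := hg.natDegree_pos
  have h2 : g.natDegree = 2 := by
    by_contra hne
    have h1 : g.degree = 1 := by
      rw [degree_eq_natDegree hg.ne_zero]
      have : g.natDegree = 1 := by omega
      rw [this]; rfl
    obtain ⟨x, hx⟩ := exists_root_of_degree_eq_one h1
    exact no_root hR hprim x (hx.dvd hgR)
  refine ⟨g * Polynomial.C g.leadingCoeff⁻¹, monic_mul_leadingCoeff_inv hg.ne_zero, ?_, ?_⟩
  · rw [natDegree_mul_leadingCoeff_inv _ hg.ne_zero, h2]
  · have hu : IsUnit (Polynomial.C g.leadingCoeff⁻¹) :=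
      isUnit_C.mpr (IsUnit.mk0 _ (inv_ne_zero (leadingCoeff_ne_zero.mpr hg.ne_zero)))
    exact (hu.mul_right_dvd).mpr hgR

theorem step {C : DQ[X]} {R : ℝ[X]} (hC : C.Monic) (hd : 0 < C.natDegree)
    (hR : C * pconj C = R.map realToDQ) (hR0 : R ≠ 0)
    (hprim : NoRealFactor (primal C)) :
    ∃ (D : DQ[X]) (h : DQ) (M R' : ℝ[X]), C = D * (X - Polynomial.C h) ∧ R' ≠ 0 ∧ M ≠ 0 ∧
      D * pconj D = R'.map realToDQ ∧
      (X - Polynomial.C h) * pconj (X - Polynomial.C h) = M.map realToDQ := by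
  obtain ⟨M, hM, hM2, R', rfl⟩ := exists_quadratic hC hd hR hR0 hprim
  have hMm : (M.map realToDQ).Monic := hM.map _
  have hdiv := modByMonic_add_div C (M.map realToDQ)
  have hdeg : (C %ₘ (M.map realToDQ)).degree ≤ 1 := by
    have := degree_modByMonic_lt C hMm
    rw [hM.degree_map, degree_eq_natDegree hM.ne_zero, hM2] at this
    exact (degree_le_iff_coeff_zero _ _).mpr fun m hm => (degree_lt_iff_coeff_zero _ 2).mp this m (by
      have : 1 < m := by exact_mod_cast hm
      omega)
  have hS := eq_X_add_C_of_degree_le_one hdeg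
  set s1 := (C %ₘ (M.map realToDQ)).coeff 1
  set s0 := (C %ₘ (M.map realToDQ)).coeff 0
  set S := C %ₘ (M.map realToDQ)
  set Q := C /ₘ (M.map realToDQ)
  have hR1 := hR
  have hdvd : M.map realToDQ ∣ S * pconj S := by
    rw [← hdiv, pconj_add, pconj_mul, pconj_real, mul_add, add_mul, add_mul, Polynomial.map_mul] at hR1
    refine (dvd_add_right (a := M.map realToDQ) (b := M.map realToDQ * Q * pconj S + (S * (pconj Q * M.map realToDQ) + M.map realToDQ * Q * (pconj Q * M.map realToDQ))) ?_).mp ?_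
    · refine dvd_add ⟨Q * pconj S, by rw [mul_assoc]⟩ (dvd_add ⟨S * pconj Q, ?_⟩ ⟨Q * (pconj Q * M.map realToDQ), by rw [mul_assoc]⟩)
      rw [real_comm, mul_assoc]
    · refine ⟨R'.map realToDQ, ?_⟩
      rw [← hR1]; abel
  have hpX : pconj X = X := by
    ext1 n
    rw [coeff_pconj, coeff_X]
    split_ifs
    · exact dconj_one
    · exact dconj_zero
  have hSc : pconj S = Polynomial.C (dconj s1) * X + Polynomial.C (dconj s0) := by
    rw [hS, pconj_add, pconj_mul, pconj_C, pconj_C, hpX, X_mul_C]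
  have hSd : S.natDegree ≤ 1 := natDegree_le_of_degree_le hdeg
  have hSSd : (S * pconj S).natDegree ≤ 2 := by
    refine natDegree_mul_le.trans ?_
    have : (pconj S).natDegree ≤ 1 := by rw [hSc]; exact natDegree_linear_le
    omega
  obtain ⟨K, hK⟩ := hdvd
  have hKC : K = Polynomial.C (K.coeff 0) := by
    apply eq_C_of_natDegree_eq_zero
    by_cases hK0 : K = 0
    · rw [hK0, natDegree_zero]
    · rw [hK, hMm.natDegree_mul' hK0, hM.natDegree_map, hM2] at hSSd
      omega
  set k := K.coeff 0
  have hprod : S * pconj S = Polynomial.C (s1 * dconj s1) * X ^ 2 +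
      Polynomial.C (s1 * dconj s0 + s0 * dconj s1) * X + Polynomial.C (s0 * dconj s0) := by
    rw [hSc, hS]
    simp only [mul_add, add_mul, Polynomial.C_mul, Polynomial.C_add]
    have e1 : Polynomial.C s1 * X * (Polynomial.C (dconj s1) * X) =
        Polynomial.C s1 * Polynomial.C (dconj s1) * X ^ 2 := by
      rw [mul_assoc, ← mul_assoc X, X_mul_C, mul_assoc, mul_assoc, pow_two]
    have e2 : Polynomial.C s1 * X * Polynomial.C (dconj s0) =
        Polynomial.C s1 * Polynomial.C (dconj s0) * X := by
      rw [mul_assoc, X_mul_C, mul_assoc]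
    rw [e1, e2, ← mul_assoc]
    abel
  rw [hKC, real_comm] at hK
  have hc2 : s1 * dconj s1 = k := by
    have h1 := congrArg (fun p => coeff p 2) (hprod.symm.trans hK)
    have h2 : (M.map realToDQ).coeff 2 = 1 := by
      have := hMm.coeff_natDegree
      rwa [hM.natDegree_map, hM2] at this
    simp only [coeff_C_mul, h2, coeff_add, coeff_X_pow, coeff_X, coeff_C] at h1
    simpa using h1
  have hc0 : s0 * dconj s0 = k * (M.map realToDQ).coeff 0 := by
    have h1 := congrArg (fun p => coeff p 0) (hprod.symm.trans hK)
    simp only [coeff_C_mul, coeff_add, coeff_X_pow, coeff_X, coeff_C] at h1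
    simpa using h1
  have hs1 : s1.fst ≠ 0 := by
    intro h
    have hk : k.fst = 0 := by
      rw [← hc2, TrivSqZeroExt.fst_mul, h, zero_mul]
    have h0 : s0.fst = 0 := by
      apply fst_norm_zero
      rw [hc0, TrivSqZeroExt.fst_mul, hk, zero_mul]
    have hpS : primal S = 0 := by
      ext1 n
      rw [coeff_primal, hS]
      simp only [coeff_add, coeff_C_mul, coeff_X, coeff_C, coeff_zero]
      split_ifs <;> simp [h, h0]
    refine hprim M (by omega) ⟨primal Q, ?_⟩
    rw [← hdiv, primal_add, primal_mul, primal_real, hpS, zero_add]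
  have hu : IsUnit s1 := TrivSqZeroExt.isUnit_iff_isUnit_fst.mpr (IsUnit.mk0 _ hs1)
  have hu' : IsUnit (dconj s1) := TrivSqZeroExt.isUnit_iff_isUnit_fst.mpr
    (IsUnit.mk0 _ (star_ne_zero.mpr hs1))
  obtain ⟨v, hv⟩ := hu.exists_right_inv
  set h : DQ := -(v * s0) with hh
  have hST : S = Polynomial.C s1 * (X - Polynomial.C h) := by
    rw [mul_sub, ← Polynomial.C_mul, hh, mul_neg, ← mul_assoc, hv, one_mul, Polynomial.C_neg, sub_neg_eq_add]
    exact hS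
  set T : DQ[X] := X - Polynomial.C h with hT
  have hTm : T.Monic := monic_X_sub_C h
  have hTT : T * pconj T = M.map realToDQ := by
    rw [hST, pconj_mul, pconj_C, ← hc2, Polynomial.C_mul, mul_assoc, mul_assoc] at hK
    have h1 := (isUnit_C.mpr hu).mul_left_cancel hK
    rw [← real_comm, ← mul_assoc] at h1
    exact (isUnit_C.mpr hu').mul_right_cancel h1
  have hTT' : pconj T * T = M.map realToDQ := by
    apply hTm.isRegular.left
    change T * _ = T * _
    rw [← mul_assoc, hTT, real_comm]
  have hCD : C = (Polynomial.C s1 + Q * pconj T) * T := by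
    rw [add_mul, mul_assoc, hTT', ← hST, ← real_comm, hdiv]
  refine ⟨Polynomial.C s1 + Q * pconj T, h, M, R', hCD, right_ne_zero_of_mul hR0, hM.ne_zero, ?_, hTT⟩
  set D := Polynomial.C s1 + Q * pconj T
  apply hMm.isRegular.left
  change _ * _ = _ * _
  rw [← Polynomial.map_mul, ← hR, hCD, pconj_mul, mul_assoc, ← mul_assoc T, hTT, real_comm M, real_comm M, mul_assoc]

theorem main_aux (n : ℕ) : ∀ (C : DQ[X]), C.Monic → C.natDegree = n →
    (∃ R : ℝ[X], R ≠ 0 ∧ C * pconj C = R.map realToDQ) → NoRealFactor (primal C) →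
    ∃ h : Fin n → DQ,
      C = (List.ofFn fun i => X - Polynomial.C (h i)).prod ∧
      ∀ i, IsMotionPoly (X - Polynomial.C (h i)) ∧ ((h i).fst).im ≠ 0 := by
  induction n with
  | zero =>
    intro C hC hd _ _
    refine ⟨fun i => 0, ?_, fun i => i.elim0⟩
    simpa using (Polynomial.Monic.natDegree_eq_zero hC).mp hd
  | succ n ih =>
    rintro C hC hd ⟨R, hR0, hR⟩ hprim
    obtain ⟨D, h, M, R', hCD, hR'0, hM0, hDR, hTM⟩ := step hC (by omega) hR hR0 hprim
    have hTm : (X - Polynomial.C h).Monic := monic_X_sub_C h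
    have hDm : D.Monic := by
      rw [hCD] at hC
      exact hTm.of_mul_monic_right hC
    have hDd : D.natDegree = n := by
      rw [hCD, hDm.natDegree_mul hTm, natDegree_X_sub_C] at hd
      omega
    have hDp : NoRealFactor (primal D) := by
      intro K hK hdvd
      refine hprim K hK ?_
      rw [hCD, primal_mul]
      exact hdvd.mul_right _
    obtain ⟨g, hg, hg'⟩ := ih D hDm hDd ⟨R', hR'0, hDR⟩ hDp
    refine ⟨Fin.snoc g h, ?_, ?_⟩
    · rw [List.ofFn_succ', List.concat_eq_append, List.prod_append]
      simp only [Fin.snoc_castSucc, Fin.snoc_last, List.prod_singleton]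
      rw [← hg, ← hCD]
    · intro i
      refine Fin.lastCases ?_ (fun j => ?_) i
      · rw [Fin.snoc_last]
        refine ⟨⟨⟨M, hM0, hTM⟩, ?_⟩, ?_⟩
        · rw [hTm.leadingCoeff]; exact isUnit_one
        · intro him
          set r := h.fst.re with hr
          have hfst : h.fst = algebraMap ℝ Quat r := by
            have := Quaternion.re_add_im h.fst
            rw [him, add_zero] at this
            exact this.symm
          have hTp : primal (X - Polynomial.C h) = (X - Polynomial.C r : ℝ[X]).map (algebraMap ℝ Quat) := by
            unfold primal
            rw [Polynomial.map_sub, Polynomial.map_sub, Polynomial.map_X, Polynomial.map_X, Polynomial.map_C, Polynomial.map_C]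
            congr 2
          refine hprim (X - Polynomial.C r) (by rw [natDegree_X_sub_C]; exact one_pos) ⟨primal D, ?_⟩
          rw [hCD, ← primal_real, ← primal_mul, real_comm, primal_mul, primal_mul, primal_real, hTp]
      · rw [Fin.snoc_castSucc]
        exact hg' j

/-- A monic motion polynomial of degree n whose primal part has no
nonconstant real factor factors into n monic linear motion polynomials
`t − hᵢ`, each with non-real primal part (rotation polynomials). -/
theorem stmt11 (n : ℕ) (C : DQ[X]) (hmonic : C.Monic) (hdeg : C.natDegree = n)
    (hmp : IsMotionPoly C) (hprim : NoRealFactor (primal C)) :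
    ∃ h : Fin n → DQ,
      C = (List.ofFn fun i => X - Polynomial.C (h i)).prod ∧
      ∀ i, IsMotionPoly (X - Polynomial.C (h i)) ∧ ((h i).fst).im ≠ 0 := by
  exact main_aux n C hmonic hdeg hmp.1 hprim
end
end

section
/- Let C ∈ ℍ[t] be a monic quaternion polynomial of degree n whose norm polynomial C·C̄ ∈ ℝ[t] is squarefree. Then C admits exactly n! factorizations into monic linear factors; that is, the set of ordered n-tuples (q₁, …, qₙ) of quaternions with C = (t − q₁)(t − q₂)⋯(t − qₙ) has exactly n! elements. -/
noncomputable section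
open Polynomial

/-- Coefficientwise (quaternion) conjugate of a polynomial over ℍ. -/
def qpconj (C : Quat[X]) : Quat[X] := C.sum fun n a => Polynomial.C (star a) * X ^ n

abbrev emb : ℝ →+* Quat := algebraMap ℝ Quat

lemma emb_inj : Function.Injective emb := (algebraMap ℝ Quat).injective

lemma coeff_qpconj (A : Quat[X]) (k : ℕ) : (qpconj A).coeff k = star (A.coeff k) := by
  unfold qpconj
  rw [Polynomial.sum_def, Polynomial.finsetSum_coeff]
  simp only [coeff_C_mul, coeff_X_pow, mul_ite, mul_one, mul_zero]
  rw [Finset.sum_ite_eq]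
  split_ifs with h
  · rfl
  · rw [notMem_support_iff.1 h, star_zero]

lemma qpconj_add (A B : Quat[X]) : qpconj (A + B) = qpconj A + qpconj B := by
  ext1 k; simp only [coeff_qpconj, coeff_add, star_add]

lemma qpconj_mul (A B : Quat[X]) : qpconj (A * B) = qpconj B * qpconj A := by
  ext1 k
  rw [coeff_qpconj, coeff_mul, coeff_mul, star_sum, ← Finset.Nat.sum_antidiagonal_swap]
  refine Finset.sum_congr rfl fun x _ => ?_
  rw [star_mul, coeff_qpconj, coeff_qpconj]
  rfl

lemma qpconj_qpconj (A : Quat[X]) : qpconj (qpconj A) = A := by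
  ext1 k; simp only [coeff_qpconj, star_star]

lemma qpconj_C (a : Quat) : qpconj (C a) = C (star a) := by
  ext1 k; rw [coeff_qpconj, coeff_C, coeff_C]; split_ifs <;> simp

lemma qpconj_X : qpconj (X : Quat[X]) = X := by
  ext1 k; rw [coeff_qpconj, coeff_X]; split_ifs <;> simp

lemma qpconj_map (P : ℝ[X]) : qpconj (P.map emb) = P.map emb := by
  ext1 k
  rw [coeff_qpconj, coeff_map]
  exact Quaternion.star_coe _

lemma qpconj_lin (q : Quat) : qpconj (X - C q) = X - C (star q) := by
  rw [sub_eq_add_neg, ← C_neg, qpconj_add, qpconj_X, qpconj_C, star_neg, C_neg, sub_eq_add_neg]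

lemma map_comm (P : ℝ[X]) (A : Quat[X]) : P.map emb * A = A * P.map emb := by
  ext1 k
  rw [coeff_mul, coeff_mul, ← Finset.Nat.sum_antidiagonal_swap]
  refine Finset.sum_congr rfl fun x _ => ?_
  simp only [coeff_map, Prod.fst_swap, Prod.snd_swap]
  exact Algebra.commutes _ _

lemma qpconj_monic {A : Quat[X]} (hA : A.Monic) :
    (qpconj A).Monic ∧ (qpconj A).natDegree = A.natDegree := by
  have hle : (qpconj A).natDegree ≤ A.natDegree := by
    rw [natDegree_le_iff_coeff_eq_zero]
    intro N hN
    rw [coeff_qpconj, coeff_eq_zero_of_natDegree_lt hN, star_zero]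
  have hc : (qpconj A).coeff A.natDegree = 1 := by
    rw [coeff_qpconj, hA.coeff_natDegree, star_one]
  exact ⟨monic_of_natDegree_le_of_coeff_eq_one _ hle hc,
    natDegree_eq_of_le_of_coeff_ne_zero hle (by rw [hc]; exact one_ne_zero)⟩

lemma exists_norm (A : Quat[X]) : ∃ N : ℝ[X], A * qpconj A = N.map emb := by
  have : A * qpconj A ∈ lifts emb := by
    rw [lifts_iff_coeff_lifts]
    intro k
    have h : qpconj (A * qpconj A) = A * qpconj A := by rw [qpconj_mul, qpconj_qpconj]
    have h2 := coeff_qpconj (A * qpconj A) k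
    rw [h] at h2
    exact ⟨_, (Quaternion.star_eq_self.1 h2.symm).symm⟩
  obtain ⟨N, hN⟩ := (mem_lifts _).1 this
  exact ⟨N, hN.symm⟩

def nrm (q : Quat) : ℝ[X] := X ^ 2 - C (2 * q.re) * X + C (Quaternion.normSq q)

lemma nrm_eq : ∀ q : Quat, (X - C q) * (X - C (star q)) = (nrm q).map emb := by
  intro q
  have h1 : emb (2 * q.re) = q + star q := by
    rw [Quaternion.self_add_star, map_mul, map_ofNat]; rfl
  have h2 : emb (Quaternion.normSq q) = q * star q := by
    rw [Quaternion.self_mul_star]; rfl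
  simp only [nrm, Polynomial.map_add, Polynomial.map_sub, Polynomial.map_mul, Polynomial.map_pow,
    map_X, map_C, h1, h2]
  rw [sub_mul, mul_sub, mul_sub, X_mul_C, ← C_mul, C_add, add_mul, sq]
  abel

lemma nrm_natDegree (q : Quat) : (nrm q).natDegree = 2 := by
  unfold nrm; compute_degree!

lemma nrm_monic (q : Quat) : (nrm q).Monic := by
  unfold nrm; monicity!

section
variable {A : Quat[X]} {R : ℝ[X]} (hR : A * qpconj A = R.map emb)

lemma sq_dvd_of_dvd {P : ℝ[X]} (hR : A * qpconj A = R.map emb) (h : P.map emb ∣ A) : P * P ∣ R := by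
  obtain ⟨Q, rfl⟩ := h
  obtain ⟨N, hN⟩ := exists_norm Q
  refine ⟨N, map_injective emb emb_inj ?_⟩
  rw [← hR, Polynomial.map_mul, Polynomial.map_mul, ← hN, qpconj_mul, qpconj_map,
    ← map_comm P (qpconj Q)]
  rw [mul_assoc, mul_assoc, ← mul_assoc Q, ← map_comm P Q, mul_assoc]

lemma dvd_rem {P : ℝ[X]} {D Q : Quat[X]} (hR : A * qpconj A = R.map emb) (hP : P ∣ R)
    (h : A = D + P.map emb * Q) : P.map emb ∣ D * qpconj D := by
  obtain ⟨T, rfl⟩ := hP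
  have hD : D * qpconj D = P.map emb * (T.map emb - D * qpconj Q - Q * qpconj A) := by
    have e1 : A * qpconj A = D * qpconj D + D * (qpconj Q * P.map emb) +
        P.map emb * Q * qpconj A := by
      have e0 : qpconj A = qpconj D + qpconj Q * P.map emb := by
        rw [h, qpconj_add, qpconj_mul, qpconj_map]
      rw [← mul_add, ← e0, ← add_mul, ← h]
    rw [hR, Polynomial.map_mul, ← map_comm P (qpconj Q), ← mul_assoc D, ← map_comm P D] at e1
    rw [mul_sub, mul_sub, e1]
    simp only [mul_assoc]
    abel
  exact ⟨_, hD⟩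

lemma const_rem {P : ℝ[X]} (hR : A * qpconj A = R.map emb) (hP : P ∣ R) (hm : P.Monic)
    (hpos : 0 < P.natDegree) {b : Quat} {Q : Quat[X]}
    (h : A = C b + P.map emb * Q) : b = 0 := by
  have h1 := dvd_rem hR hP h
  rw [qpconj_C, ← C_mul, Quaternion.self_mul_star] at h1
  have h2 : P.map emb ∣ (C (Quaternion.normSq b) : ℝ[X]).map emb := by
    rw [map_C]; exact h1
  rw [map_dvd_map emb emb_inj hm] at h2
  by_contra hb
  have := natDegree_le_of_dvd h2 (by simpa using hb)
  rw [natDegree_C] at this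
  omega

lemma natDegree_of_irr {P : ℝ[X]} (hR : A * qpconj A = R.map emb) (hsf : Squarefree R)
    (hP : P ∣ R) (hm : P.Monic) (hi : Irreducible P) : P.natDegree = 2 := by
  have h2 := hi.natDegree_le_two
  have h0 := hi.natDegree_pos
  by_contra hne
  have h1 : P.natDegree = 1 := by omega
  have hm' : (P.map emb).Monic := hm.map emb
  have hd := natDegree_modByMonic_lt A hm' (by
    intro h
    have := congrArg natDegree h
    rw [hm.natDegree_map, h1, natDegree_one] at this
    omega)
  rw [hm.natDegree_map, h1, Nat.lt_one_iff] at hd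
  obtain ⟨b, hb⟩ := natDegree_eq_zero.1 hd
  have hdiv := (modByMonic_add_div A (P.map emb)).symm
  rw [← hb] at hdiv
  have hb0 := const_rem hR hP hm h0 hdiv
  rw [hb0, C_0, zero_add] at hdiv
  exact hi.not_isUnit (hsf _ (sq_dvd_of_dvd hR ⟨_, hdiv⟩))

lemma exists_rem {P : ℝ[X]} (hR : A * qpconj A = R.map emb) (hsf : Squarefree R)
    (hP : P ∣ R) (hm : P.Monic) (h2 : P.natDegree = 2) :
    ∃ (a b : Quat) (Q : Quat[X]), a ≠ 0 ∧ A = C a * X + C b + P.map emb * Q := by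
  have hm' : (P.map emb).Monic := hm.map emb
  have hd := natDegree_modByMonic_lt A hm' (by
    intro h
    have := congrArg natDegree h
    rw [hm.natDegree_map, h2, natDegree_one] at this
    omega)
  rw [hm.natDegree_map, h2] at hd
  obtain ⟨a, b, hab⟩ := exists_eq_X_add_C_of_natDegree_le_one (Nat.lt_succ_iff.1 hd)
  have hdiv := (modByMonic_add_div A (P.map emb)).symm
  rw [hab] at hdiv
  refine ⟨a, b, _, ?_, hdiv⟩
  rintro rfl
  rw [C_0, zero_mul, zero_add] at hdiv
  have hb0 := const_rem hR hP hm (by omega) hdiv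
  rw [hb0, C_0, zero_add] at hdiv
  have := natDegree_eq_zero_of_isUnit (hsf _ (sq_dvd_of_dvd hR ⟨_, hdiv⟩))
  omega

lemma exists_root {P : ℝ[X]} (hR : A * qpconj A = R.map emb) (hsf : Squarefree R)
    (hP : P ∣ R) (hm : P.Monic) (h2 : P.natDegree = 2) :
    ∃ q : Quat, X - C q ∣ A ∧ nrm q = P := by
  obtain ⟨a, b, Q, ha, h⟩ := exists_rem hR hsf hP hm h2
  set q : Quat := -b * a⁻¹ with hq
  have hqa : q * a = -b := by rw [hq, mul_assoc, inv_mul_cancel₀ ha, mul_one]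
  have hD : C a * X + C b = (X - C q) * C a := by
    rw [sub_mul, ← C_mul, hqa, X_mul_C, C_neg, sub_neg_eq_add]
  have hN : nrm q = P := by
    have h1 := dvd_rem hR hP h
    rw [hD, qpconj_mul, qpconj_C, qpconj_lin, ← mul_assoc, mul_assoc _ (C a), ← C_mul,
      Quaternion.self_mul_star] at h1
    have e : (X - C q) * C ((Quaternion.normSq a : ℝ) : Quat) * (X - C (star q))
        = (C (Quaternion.normSq a) * nrm q).map emb := by
      rw [Polynomial.map_mul, ← nrm_eq, ← mul_assoc, map_comm, map_C]
      rfl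
    rw [e, map_dvd_map emb emb_inj hm] at h1
    have hu : IsUnit (C (Quaternion.normSq a) : ℝ[X]) := by
      rw [isUnit_C, isUnit_iff_ne_zero]; simpa using ha
    rw [hu.dvd_mul_left] at h1
    exact eq_of_monic_of_dvd_of_natDegree_le hm (nrm_monic q) h1 (by rw [nrm_natDegree, h2])
  refine ⟨q, ?_, hN⟩
  rw [h, hD, ← hN, ← nrm_eq, mul_assoc, ← mul_add]
  exact dvd_mul_right _ _

lemma root_eq {a b q : Quat} {F : Quat[X]} (ha : a ≠ 0)
    (h : C a * X + C b = (X - C q) * F) : q = -b * a⁻¹ := by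
  have hF : F ≠ 0 := by
    rintro rfl
    have := congrArg (fun p => coeff p 1) h
    simp at this
    exact ha this
  have hdeg := congrArg natDegree h
  rw [natDegree_linear ha, natDegree_mul (X_sub_C_ne_zero q) hF, natDegree_X_sub_C] at hdeg
  obtain ⟨f, rfl⟩ := natDegree_eq_zero.1 (show F.natDegree = 0 by omega)
  rw [sub_mul, X_mul_C, ← C_mul] at h
  have h1 := congrArg (fun p => coeff p 1) h
  have h0 := congrArg (fun p => coeff p 0) h
  simp [coeff_C] at h1 h0
  rw [h0, ← h1, neg_neg, mul_assoc, mul_inv_cancel₀ ha, mul_one]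

lemma dvd_of_root {q : Quat} {B : Quat[X]} {R' : ℝ[X]} (hR : A * qpconj A = R.map emb)
    (h : A = (X - C q) * B) (hB : B * qpconj B = R'.map emb) : R = nrm q * R' := by
  apply map_injective emb emb_inj
  rw [← hR, h, qpconj_mul, qpconj_lin, ← mul_assoc, mul_assoc _ B, hB, ← map_comm, mul_assoc,
    nrm_eq, ← Polynomial.map_mul, mul_comm]

lemma root_unique {q q' : Quat} (hR : A * qpconj A = R.map emb) (hsf : Squarefree R)
    (h : X - C q ∣ A) (h' : X - C q' ∣ A) (hn : nrm q = nrm q') : q = q' := by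
  obtain ⟨B, hB⟩ := h
  obtain ⟨N, hN⟩ := exists_norm B
  have hP : nrm q ∣ R := ⟨N, dvd_of_root hR hB hN⟩
  obtain ⟨a, b, Q, ha, hA⟩ := exists_rem hR hsf hP (nrm_monic q) (nrm_natDegree q)
  obtain ⟨B', hB'⟩ := h'
  have e1 : C a * X + C b = (X - C q) * (B - (X - C (star q)) * Q) := by
    rw [mul_sub, ← hB, ← mul_assoc, nrm_eq, hA]; abel
  have e2 : C a * X + C b = (X - C q') * (B' - (X - C (star q')) * Q) := by
    rw [mul_sub, ← hB', ← mul_assoc, nrm_eq, hA, hn]; abel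
  rw [root_eq ha e1, root_eq ha e2]

end

open UniqueFactorizationMonoid in
lemma card_roots_eq {A : Quat[X]} {R : ℝ[X]} (hA : A.Monic) (hR : A * qpconj A = R.map emb)
    (hsf : Squarefree R) :
    Finite {q : Quat // X - C q ∣ A} ∧ Nat.card {q : Quat // X - C q ∣ A} = A.natDegree := by
  classical
  have hm' : (R.map emb).Monic := by rw [← hR]; exact hA.mul (qpconj_monic hA).1
  have hm : R.Monic := (monic_map_iff (f := emb)).1 hm'
  have hd : R.natDegree = 2 * A.natDegree := by
    rw [← hm.natDegree_map emb, ← hR, hA.natDegree_mul (qpconj_monic hA).1,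
      (qpconj_monic hA).2]; ring
  have hR0 := hm.ne_zero
  have hmon : ∀ P ∈ normalizedFactors R, P.Monic := by
    intro P hP
    have := (mem_normalizedFactors_iff' hR0).1 hP
    rw [← this.2.1]
    exact monic_normalize this.1.ne_zero
  have hdeg2 : ∀ P ∈ normalizedFactors R, P.natDegree = 2 := by
    intro P hP
    have := (mem_normalizedFactors_iff' hR0).1 hP
    exact natDegree_of_irr hR hsf this.2.2 (hmon P hP) this.1
  have hcard : (normalizedFactors R).card = A.natDegree := by
    have h1 := natDegree_eq_of_degree_eq
      (degree_eq_degree_of_associated (prod_normalizedFactors hR0))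
    rw [natDegree_multiset_prod_of_monic _ hmon, Multiset.map_congr rfl hdeg2,
      Multiset.map_const', Multiset.sum_replicate, hd, smul_eq_mul] at h1
    omega
  have hnd := (squarefree_iff_nodup_normalizedFactors hR0).1 hsf
  have hmem : ∀ q : {q : Quat // X - C q ∣ A}, nrm q.1 ∈ (normalizedFactors R).toFinset := by
    rintro ⟨q, B, hB⟩
    obtain ⟨N, hN⟩ := exists_norm B
    have hP : nrm q ∣ R := ⟨N, dvd_of_root hR hB hN⟩
    have hnu : ¬ IsUnit (nrm q) := fun h => by
      have := natDegree_eq_zero_of_isUnit h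
      rw [nrm_natDegree] at this; omega
    obtain ⟨P, hPm, hPi, hPd⟩ := exists_monic_irreducible_factor (nrm q) hnu
    have h2 := natDegree_of_irr hR hsf (hPd.trans hP) hPm hPi
    have := eq_of_monic_of_dvd_of_natDegree_le hPm (nrm_monic q) hPd (by rw [nrm_natDegree, h2])
    rw [Multiset.mem_toFinset, mem_normalizedFactors_iff' hR0]
    exact ⟨this ▸ hPi, (nrm_monic q).normalize_eq_self, hP⟩
  let f : {q : Quat // X - C q ∣ A} → (normalizedFactors R).toFinset := fun q => ⟨nrm q.1, hmem q⟩
  have hf : Function.Bijective f := by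
    constructor
    · intro q q' h
      exact Subtype.ext (root_unique hR hsf q.2 q'.2 (congrArg Subtype.val h))
    · rintro ⟨P, hP⟩
      rw [Multiset.mem_toFinset] at hP
      obtain ⟨q, hq, hq'⟩ := exists_root hR hsf
        ((mem_normalizedFactors_iff' hR0).1 hP).2.2 (hmon P hP) (hdeg2 P hP)
      exact ⟨⟨q, hq⟩, Subtype.ext hq'⟩
  refine ⟨Finite.of_injective f hf.1, ?_⟩
  rw [Nat.card_eq_of_bijective f hf, Nat.card_eq_fintype_card, Fintype.card_coe,
    Multiset.toFinset_card_of_nodup hnd, hcard]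

open Nat in
lemma main_aux_s13 (n : ℕ) : ∀ (A : Quat[X]) (R : ℝ[X]), A.Monic → A.natDegree = n →
    A * qpconj A = R.map emb → Squarefree R →
    Finite {q : Fin n → Quat // A = (List.ofFn fun i => X - C (q i)).prod} ∧
    Nat.card {q : Fin n → Quat // A = (List.ofFn fun i => X - C (q i)).prod} = n ! := by
  induction n with
  | zero =>
    intro A R hA hd _ _
    have h1 : A = 1 := hA.natDegree_eq_zero.1 hd
    subst h1
    refine ⟨inferInstance, ?_⟩
    rw [Nat.card_eq_one_iff_unique.2 ⟨inferInstance, ⟨⟨Fin.elim0, by simp⟩⟩⟩]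
    rfl
  | succ n ih =>
    intro A R hA hd hR hsf
    obtain ⟨hfin, hcard⟩ := card_roots_eq hA hR hsf
    choose B hB using fun q : {q : Quat // X - C q ∣ A} => q.2
    have key : ∀ q, Finite {p : Fin n → Quat // B q = (List.ofFn fun i => X - C (p i)).prod} ∧
        Nat.card {p : Fin n → Quat // B q = (List.ofFn fun i => X - C (p i)).prod} = n ! := by
      intro q
      obtain ⟨N, hN⟩ := exists_norm (B q)
      have hBm : (B q).Monic := (monic_X_sub_C q.1).of_mul_monic_left (hB q ▸ hA)
      refine ih (B q) N hBm ?_ hN ?_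
      · have := congrArg natDegree (hB q)
        rw [(monic_X_sub_C q.1).natDegree_mul hBm, natDegree_X_sub_C] at this
        omega
      · exact hsf.squarefree_of_dvd ⟨nrm q.1, by rw [dvd_of_root hR (hB q) hN, mul_comm]⟩
    have := fun q => (key q).1
    have := Fintype.ofFinite {q : Quat // X - C q ∣ A}
    let f : (Σ q : {q : Quat // X - C q ∣ A},
        {p : Fin n → Quat // B q = (List.ofFn fun i => X - C (p i)).prod}) →
        {q : Fin (n + 1) → Quat // A = (List.ofFn fun i => X - C (q i)).prod} :=
      fun x => ⟨Fin.cons x.1.1 x.2.1, by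
        rw [List.ofFn_succ, List.prod_cons]
        simp only [Fin.cons_zero, Fin.cons_succ]
        rw [← x.2.2]; exact hB x.1⟩
    have hf : Function.Bijective f := by
      constructor
      · rintro ⟨q, p⟩ ⟨q', p'⟩ h
        have h0 : (Fin.cons q.1 p.1 : Fin (n + 1) → Quat) = Fin.cons q'.1 p'.1 :=
          congrArg Subtype.val h
        have h1 := Fin.cons_inj.1 h0
        obtain rfl : q = q' := Subtype.ext h1.1
        obtain rfl : p = p' := Subtype.ext h1.2
        rfl
      · rintro ⟨q, hq⟩
        have hq2 := hq
        rw [List.ofFn_succ, List.prod_cons] at hq2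
        refine ⟨⟨⟨q 0, _, hq2⟩, ⟨fun i => q i.succ, ?_⟩⟩, ?_⟩
        · have := (hB ⟨q 0, _, hq2⟩).symm.trans hq2
          exact mul_left_cancel₀ (X_sub_C_ne_zero (q 0)) this
        · apply Subtype.ext
          exact Fin.cons_self_tail q
    refine ⟨Finite.of_surjective f hf.2, ?_⟩
    rw [← Nat.card_eq_of_bijective f hf, Nat.card_sigma, Finset.sum_congr rfl fun q _ => (key q).2,
      Finset.sum_const, Finset.card_univ, ← Nat.card_eq_fintype_card, hcard, hd, smul_eq_mul,
      Nat.factorial_succ]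

open Nat in
/-- A monic quaternion polynomial of degree n whose (real) norm
polynomial C·C̄ is squarefree admits exactly n! factorizations into monic linear
factors. -/
theorem stmt13 (n : ℕ) (C : Quat[X]) (hmonic : C.Monic) (hdeg : C.natDegree = n)
    (R : ℝ[X]) (hR : C * qpconj C = R.map (algebraMap ℝ Quat)) (hsf : Squarefree R) :
    {q : Fin n → Quat |
        C = (List.ofFn fun i => X - Polynomial.C (q i)).prod}.Finite ∧
    {q : Fin n → Quat |
        C = (List.ofFn fun i => X - Polynomial.C (q i)).prod}.ncard = n ! := by
  obtain ⟨h1, h2⟩ := main_aux_s13 n C R hmonic hdeg hR hsf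
  exact ⟨Set.finite_coe_iff.1 h1, h2⟩
end
end
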